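/- If p > 1, then for every t ∈ ℝ the sublevel set {μ ∈ KRu(Z) : G_{α,β}(μ) ≤ t} is compact in the topology induced by the Kantorovich–Rubinstein norm ‖·‖_KRu. -/

import Mathlib

open MeasureTheory Filter Topology
open scoped ENNReal NNReal

noncomputable section
attribute [local instance] Classical.propDecidable

variable {Z : Type*} [MetricSpace Z] [MeasurableSpace Z] [BorelSpace Z]

/-- Integral `∫ f dμ` of a function against a finite signed measure, via Jordan decomposition. -/
def sInteg (μ : SignedMeasure Z) (f : Z → ℝ) : ℝ :=
  (∫ z, f z ∂μ.toJordanDecomposition.posPart) - ∫ z, f z ∂μ.toJordanDecomposition.negPart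

/-- Total variation norm `‖μ‖_TV`. -/
def tvNorm (μ : SignedMeasure Z) : ℝ := (μ.totalVariation Set.univ).toReal

/-- The unbalanced Kantorovich–Rubinstein norm
`‖μ‖_KRu = |μ(Z)| + sup { ∫ f dμ : f(e) = 0, Lip(f) ≤ 1 }`. -/
def kruNorm (e : Z) (μ : SignedMeasure Z) : ℝ :=
  |μ Set.univ| +
    sSup {r : ℝ | ∃ f : Z → ℝ, f e = 0 ∧ LipschitzWith 1 f ∧ r = sInteg μ f}

/-- The balanced Kantorovich–Rubinstein norm `‖μ‖_KR = sup { ∫ f dμ : f(e) = 0, Lip(f) ≤ 1 }`. -/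
def krNorm (e : Z) (μ : SignedMeasure Z) : ℝ :=
  sSup {r : ℝ | ∃ f : Z → ℝ, f e = 0 ∧ LipschitzWith 1 f ∧ r = sInteg μ f}

/-- `μ ∈ M_1(Z)`: finite first moment, `∫ d(z,e) d|μ| < ∞`. -/
def MemM1 (e : Z) (μ : SignedMeasure Z) : Prop :=
  (∫⁻ z, ENNReal.ofReal (dist z e) ∂μ.totalVariation) < ⊤

/-- `μ ∈ M_p(Z)`: finite `p`-th moment, `∫ d(z,e)^p d|μ| < ∞`. -/
def MemMp (e : Z) (p : ℝ) (μ : SignedMeasure Z) : Prop :=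
  (∫⁻ z, ENNReal.ofReal (dist z e ^ p) ∂μ.totalVariation) < ⊤

/-- `∫ (1 + d(z,e)^p) d|μ|` as an extended nonnegative real number. -/
def momLint (e : Z) (p : ℝ) (μ : SignedMeasure Z) : ℝ≥0∞ :=
  ∫⁻ z, ENNReal.ofReal (1 + dist z e ^ p) ∂μ.totalVariation

/-- Dirac measure at a point, as a signed measure. -/
def diracSM (x : Z) : SignedMeasure Z := (Measure.dirac x).toSignedMeasure

/-- The regularizer `G_{α,β}(μ) = α‖μ‖_KRu + β ∫ (1 + d(z,e)^p) d|μ|` if `μ ∈ M_p(Z)`,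
and `+∞` otherwise, as an extended real number. -/
def Gab (e : Z) (p α β : ℝ) (μ : SignedMeasure Z) : EReal :=
  if MemMp e p μ then ((α * kruNorm e μ + β * (momLint e p μ).toReal : ℝ) : EReal) else ⊤

/-- A geodesic metric space: any two points are joined by points realizing all
intermediate distance proportions. -/
def IsGeodesic (Z : Type*) [MetricSpace Z] : Prop :=
  ∀ x y : Z, ∀ t : ℝ, 0 ≤ t → t ≤ 1 →
    ∃ z : Z, dist x z = t * dist x y ∧ dist z y = (1 - t) * dist x y


set_option linter.unusedSectionVars false

/-- Points of a larger ball are close to the smaller ball. -/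
lemma geo_near (hgeo : IsGeodesic Z) (e x : Z) (r s : ℝ) (hr : 0 ≤ r) (hs : 0 ≤ s)
    (hx : dist x e ≤ r + s) : ∃ z, dist z e ≤ r ∧ dist x z ≤ s := by
  by_cases h : dist x e ≤ r
  · exact ⟨x, h, by simpa using hs⟩
  · push Not at h
    have hd : 0 < dist e x := by rw [dist_comm]; linarith
    rw [dist_comm] at h hx
    obtain ⟨z, h1, h2⟩ := hgeo e x (r / dist e x) (by positivity)
      ((div_le_one hd).2 h.le)
    refine ⟨z, ?_, ?_⟩
    · rw [dist_comm, h1, div_mul_cancel₀ _ hd.ne']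
    · rw [dist_comm, h2, sub_mul, div_mul_cancel₀ _ hd.ne']; linarith

/-- Hopf–Rinow. -/
lemma geo_proper [LocallyCompactSpace Z] [CompleteSpace Z] (hgeo : IsGeodesic Z) (e : Z) :
    ∀ r : ℝ, IsCompact (Metric.closedBall e r) := by
  by_contra! hcon
  obtain ⟨r₀, hr₀⟩ := hcon
  set S : Set ℝ := {r | IsCompact (Metric.closedBall e r)} with hS
  have hdown : ∀ r ∈ S, ∀ s ≤ r, s ∈ S := fun r hr s hs =>
    IsCompact.of_isClosed_subset hr Metric.isClosed_closedBall (Metric.closedBall_subset_closedBall hs)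
  have h0 : (0 : ℝ) ∈ S := by simp [hS]
  have hbdd : BddAbove S := ⟨r₀, fun r hr => by
    by_contra! h
    exact hr₀ (hdown r hr r₀ h.le)⟩
  set R := sSup S with hR
  have hR0 : 0 ≤ R := le_csSup hbdd h0
  have hlt : ∀ r < R, r ∈ S := fun r hr => by
    obtain ⟨s, hs, hrs⟩ := exists_lt_of_lt_csSup ⟨0, h0⟩ hr
    exact hdown s hs r hrs.le
  have hRS : IsCompact (Metric.closedBall e R) := by
    refine TotallyBounded.isCompact_of_isClosed ?_ Metric.isClosed_closedBall
    rcases hR0.eq_or_lt with h | hpos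
    · rw [← h]; simp
    rw [Metric.totallyBounded_iff]
    intro ε hε
    set r := max (R - ε / 2) 0 with hrdef
    have hr : r < R := max_lt (by linarith) hpos
    obtain ⟨T, hT, hcov⟩ := Metric.totallyBounded_iff.1
      (IsCompact.totallyBounded (hlt r hr)) (ε / 2) (by linarith)
    refine ⟨T, hT, fun x hx => ?_⟩
    obtain ⟨z, hz, hxz⟩ := geo_near hgeo e x r (ε / 2) (le_max_right _ _) (by linarith)
      (by have := le_max_left (R - ε / 2) 0
          have hx' : dist x e ≤ R := hx
          linarith)
    have := hcov (show z ∈ Metric.closedBall e r from hz)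
    simp only [Set.mem_iUnion, Metric.mem_ball] at this ⊢
    obtain ⟨y, hy, hzy⟩ := this
    exact ⟨y, hy, by linarith [dist_triangle x z y]⟩
  obtain ⟨δ, hδ, hc⟩ := hRS.exists_isCompact_cthickening
  have : R + δ ∈ S := by
    refine IsCompact.of_isClosed_subset hc Metric.isClosed_closedBall fun x hx => ?_
    obtain ⟨z, hz, hxz⟩ := geo_near hgeo e x R δ hR0 hδ.le hx
    exact Metric.mem_cthickening_of_dist_le x z δ _ hz hxz
  linarith [le_csSup hbdd this]

/-- The weight `1 + d^p`. -/
def hw (e : Z) (p : ℝ) (z : Z) : ℝ := 1 + dist z e ^ p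

lemma hw_cont (e : Z) (p : ℝ) (hp : 1 < p) : Continuous (hw e p) := by
  unfold hw
  exact continuous_const.add
    ((continuous_id.dist continuous_const).rpow_const (fun _ => Or.inr (by linarith)))

lemma hw_ge_one (e : Z) (p : ℝ) (z : Z) : 1 ≤ hw e p z := by
  unfold hw
  have := Real.rpow_nonneg (dist_nonneg (x := z) (y := e)) p
  linarith

lemma le_rpow_of_ge (p : ℝ) (hp : 1 < p) (x : ℝ) (hx : 1 ≤ x) : x ≤ x ^ p := by
  simpa using Real.rpow_le_rpow_of_exponent_le hx hp.le

lemma dist_le_hw (e : Z) (p : ℝ) (hp : 1 < p) (z : Z) : dist z e ≤ hw e p z := by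
  unfold hw
  have := Real.rpow_nonneg (dist_nonneg (x := z) (y := e)) p
  rcases le_total (dist z e) 1 with h | h
  · linarith
  · linarith [le_rpow_of_ge p hp _ h]

/-- Normalized `1`-Lipschitz functions. -/
def Lset (e : Z) : Set (Z → ℝ) := {f | f e = 0 ∧ LipschitzWith 1 f}

lemma Lset_abs {e : Z} {f : Z → ℝ} (hf : f ∈ Lset e) (z : Z) : |f z| ≤ dist z e := by
  have := hf.2.dist_le_mul z e
  simpa [Real.dist_eq, hf.1] using this

/-- For large radius, `d ≤ η d^p` outside of the ball. -/
lemma exists_radius (p : ℝ) (hp : 1 < p) (η : ℝ) (hη : 0 < η) :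
    ∃ R : ℝ, 0 < R ∧ ∀ x, R < x → x ≤ η * x ^ p := by
  have h1 : Tendsto (fun x : ℝ => x ^ (p - 1)) atTop atTop := tendsto_rpow_atTop (by linarith)
  obtain ⟨R, hR⟩ := eventually_atTop.1 (h1.eventually_ge_atTop (1 / η))
  refine ⟨max R 1, by positivity, fun x hx => ?_⟩
  have hx1 : 1 < x := lt_of_le_of_lt (le_max_right _ _) hx
  have := hR x (le_trans (le_max_left _ _) hx.le)
  have e1 : x ^ p = x ^ (p - 1) * x := by
    rw [← Real.rpow_add_one (by linarith)]; ring_nf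
  rw [div_le_iff₀ hη] at this
  rw [e1]
  nlinarith

open BoundedContinuousFunction in
/-- Truncation. -/
lemma exists_trunc (e : Z) (p : ℝ) (hp : 1 < p) (η : ℝ) (hη : 0 < η) (f : Z → ℝ)
    (hf : f ∈ Lset e) : ∃ g : Z →ᵇ ℝ, ∀ z, |f z - g z| ≤ η * hw e p z := by
  obtain ⟨R, hR0, hR⟩ := exists_radius p hp η hη
  refine ⟨BoundedContinuousFunction.ofNormedAddCommGroup (fun z => max (-R) (min (f z) R))
    (continuous_const.max (hf.2.continuous.min continuous_const)) R ?_, fun z => ?_⟩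
  · intro z
    rw [Real.norm_eq_abs, abs_le]
    exact ⟨le_max_left _ _, max_le (by linarith) (min_le_right _ _)⟩
  · have hab := Lset_abs hf z
    have hn := Real.rpow_nonneg (dist_nonneg (x := z) (y := e)) p
    simp only [BoundedContinuousFunction.coe_ofNormedAddCommGroup]
    by_cases hz : dist z e ≤ R
    · have := abs_le.1 (hab.trans hz)
      rw [min_eq_left this.2, max_eq_right this.1]
      have := hw_ge_one e p z
      simp only [sub_self, abs_zero]; positivity
    · push Not at hz
      have h2 := hR _ hz
      have h3 : |f z - max (-R) (min (f z) R)| ≤ dist z e := by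
        rw [abs_le] at hab ⊢
        rcases le_total (f z) R with h | h
        · rw [min_eq_left h]
          rcases le_total (-R) (f z) with h' | h'
          · rw [max_eq_right h']; constructor <;> linarith
          · rw [max_eq_left h']; constructor <;> linarith
        · rw [min_eq_right h, max_eq_right (by linarith)]; constructor <;> linarith
      unfold hw
      nlinarith

/-- Finite nets of the Lipschitz ball in weighted sup norm. -/
lemma exists_net (e : Z) (hprop : ∀ r : ℝ, IsCompact (Metric.closedBall e r))
    (p : ℝ) (hp : 1 < p) (η : ℝ) (hη : 0 < η) :
    ∃ T : Set (Z → ℝ), T.Finite ∧ T ⊆ Lset e ∧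
      ∀ f ∈ Lset e, ∃ g ∈ T, ∀ z, |f z - g z| ≤ η * hw e p z := by
  obtain ⟨R, hR0, hR⟩ := exists_radius p hp (η / 2) (by linarith)
  obtain ⟨s, hs, hcov⟩ := Metric.totallyBounded_iff.1 (hprop R).totallyBounded (η / 3) (by linarith)
  have := hs.fintype
  let ev : (Z → ℝ) → (s → ℝ) := fun f z => f z
  have hTB : TotallyBounded (ev '' Lset e) := by
    refine TotallyBounded.subset ?_ (isCompact_univ_pi
      (fun z : s => isCompact_Icc (a := -dist (z : Z) e) (b := dist (z : Z) e))).totallyBounded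
    rintro _ ⟨f, hf, rfl⟩ z -
    exact abs_le.1 (Lset_abs hf z)
  obtain ⟨T, hTsub, hTfin, hT'⟩ := Set.exists_subset_image_finite_and.1
    (Metric.finite_approx_of_totallyBounded hTB (η / 3) (by linarith))
  refine ⟨T, hTfin, hTsub, fun f hf => ?_⟩
  have hmem := hT' ⟨f, hf, rfl⟩
  simp only [Set.mem_iUnion, Metric.mem_ball] at hmem
  obtain ⟨_, ⟨g, hg, rfl⟩, hfg⟩ := hmem
  refine ⟨g, hg, fun z => ?_⟩
  have hgL := hTsub hg
  have hn := Real.rpow_nonneg (dist_nonneg (x := z) (y := e)) p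
  by_cases hz : dist z e ≤ R
  · have := hcov (show z ∈ Metric.closedBall e R from hz)
    simp only [Set.mem_iUnion, Metric.mem_ball] at this
    obtain ⟨y, hy, hzy⟩ := this
    have h1 := (dist_le_pi_dist (ev f) (ev g) ⟨y, hy⟩).trans hfg.le
    have h2 := hf.2.dist_le_mul z y
    have h3 := hgL.2.dist_le_mul z y
    simp only [Real.dist_eq, NNReal.coe_one, one_mul, ev] at h1 h2 h3
    have h4 : |f z - g z| ≤ η := by
      rw [abs_le] at *
      constructor <;> linarith
    have := hw_ge_one e p z
    nlinarith
  · push Not at hz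
    have h1 := Lset_abs hf z
    have h2 := Lset_abs hgL z
    have h3 := hR _ hz
    have h4 := abs_sub (f z) (g z)
    unfold hw
    nlinarith

open BoundedContinuousFunction in
lemma exists_net_bcf (e : Z) (hprop : ∀ r : ℝ, IsCompact (Metric.closedBall e r))
    (p : ℝ) (hp : 1 < p) (η : ℝ) (hη : 0 < η) :
    ∃ T : Set (Z →ᵇ ℝ), T.Finite ∧
      ∀ f ∈ Lset e, ∃ g ∈ T, ∀ z, |f z - g z| ≤ η * hw e p z := by
  obtain ⟨T, hT, hTL, hnet⟩ := exists_net e hprop p hp (η / 2) (by linarith)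
  have key : ∀ f : Z → ℝ, ∃ g : Z →ᵇ ℝ, f ∈ Lset e → ∀ z, |f z - g z| ≤ η / 2 * hw e p z := by
    intro f
    by_cases hf : f ∈ Lset e
    · obtain ⟨g, hg⟩ := exists_trunc e p hp (η / 2) (by linarith) f hf
      exact ⟨g, fun _ => hg⟩
    · exact ⟨0, fun h => absurd h hf⟩
  choose tr htr using key
  refine ⟨tr '' T, hT.image _, fun f hf => ?_⟩
  obtain ⟨g, hg, hfg⟩ := hnet f hf
  refine ⟨tr g, ⟨g, hg, rfl⟩, fun z => ?_⟩
  have h1 := hfg z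
  have h2 := htr g (hTL hg) z
  have h3 := abs_sub_le (f z) (g z) (tr g z)
  linarith

lemma int_hw {e : Z} {p : ℝ} (hp : 1 < p) {a : Measure Z}
    (ha : ∫⁻ z, ENNReal.ofReal (hw e p z) ∂a < ⊤) : Integrable (hw e p) a := by
  refine ⟨(hw_cont e p hp).aestronglyMeasurable, ?_⟩
  rw [hasFiniteIntegral_iff_ofReal]
  · exact ha
  · exact ae_of_all _ fun z => by have := hw_ge_one e p z; simp only [Pi.zero_apply]; linarith

lemma int_Lset {e : Z} {p : ℝ} (hp : 1 < p) {a : Measure Z} (ha : Integrable (hw e p) a)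
    {f : Z → ℝ} (hf : f ∈ Lset e) : Integrable f a := by
  refine ha.mono' hf.2.continuous.aestronglyMeasurable (ae_of_all _ fun z => ?_)
  exact (Lset_abs hf z).trans (dist_le_hw e p hp z)

lemma integral_hw_le {e : Z} {p : ℝ} (hp : 1 < p) {a : Measure Z} {C : ℝ} (hC : 0 ≤ C)
    (ha : ∫⁻ z, ENNReal.ofReal (hw e p z) ∂a ≤ ENNReal.ofReal C) : ∫ z, hw e p z ∂a ≤ C := by
  rw [integral_eq_lintegral_of_nonneg_ae
    (ae_of_all _ fun z => by have := hw_ge_one e p z; simp only [Pi.zero_apply]; linarith)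
    (hw_cont e p hp).aestronglyMeasurable]
  exact ENNReal.toReal_le_of_le_ofReal hC ha

lemma integral_close {e : Z} {p : ℝ} {a : Measure Z}
    (ha : Integrable (hw e p) a) {C : ℝ} (hC : ∫ z, hw e p z ∂a ≤ C) {η : ℝ} (hη : 0 ≤ η)
    {f g : Z → ℝ} (hf : Integrable f a) (hg : Integrable g a)
    (h : ∀ z, |f z - g z| ≤ η * hw e p z) : |∫ z, f z ∂a - ∫ z, g z ∂a| ≤ η * C := by
  rw [← integral_sub hf hg]
  refine (abs_integral_le_integral_abs).trans ?_
  refine (integral_mono (hf.sub hg).abs (ha.const_mul η) h).trans ?_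
  rw [integral_const_mul]
  exact mul_le_mul_of_nonneg_left hC hη

/-- Uniform convergence over the Lipschitz ball. -/
lemma unif_conv (e : Z) (hprop : ∀ r : ℝ, IsCompact (Metric.closedBall e r))
    (p : ℝ) (hp : 1 < p) {ι : Type*} {l : Filter ι} (A : ι → FiniteMeasure Z) (a : FiniteMeasure Z)
    (hA : Tendsto A l (𝓝 a)) (C : ℝ) (hC : 0 ≤ C)
    (hAC : ∀ i, ∫⁻ z, ENNReal.ofReal (hw e p z) ∂(A i : Measure Z) ≤ ENNReal.ofReal C)
    (haC : ∫⁻ z, ENNReal.ofReal (hw e p z) ∂(a : Measure Z) ≤ ENNReal.ofReal C)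
    (ε : ℝ) (hε : 0 < ε) :
    ∀ᶠ i in l, ∀ f ∈ Lset e,
      |∫ z, f z ∂(A i : Measure Z) - ∫ z, f z ∂(a : Measure Z)| ≤ ε := by
  set η := ε / (4 * (C + 1)) with hη
  have hη0 : 0 < η := by positivity
  have hηC : η * C ≤ ε / 4 := by
    rw [hη, div_mul_eq_mul_div, div_le_div_iff₀ (by positivity) (by norm_num)]
    nlinarith
  obtain ⟨T, hT, hnet⟩ := exists_net_bcf e hprop p hp η hη0
  have hconv := FiniteMeasure.tendsto_iff_forall_integral_tendsto.1 hA
  have hev : ∀ᶠ i in l, ∀ g ∈ T,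
      |∫ z, g z ∂(A i : Measure Z) - ∫ z, g z ∂(a : Measure Z)| ≤ ε / 2 := by
    rw [hT.eventually_all]
    intro g _
    have := Metric.tendsto_nhds.1 (hconv g) (ε / 2) (by linarith)
    filter_upwards [this] with i hi
    rw [Real.dist_eq] at hi
    exact hi.le
  filter_upwards [hev] with i hi f hf
  obtain ⟨g, hg, hfg⟩ := hnet f hf
  have h1 := hi g hg
  have iA := int_hw hp ((hAC i).trans_lt ENNReal.ofReal_lt_top)
  have ia := int_hw hp (haC.trans_lt ENNReal.ofReal_lt_top)
  have h2 := integral_close iA (integral_hw_le hp hC (hAC i)) hη0.le (int_Lset hp iA hf)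
    (g.integrable _) hfg
  have h3 := integral_close ia (integral_hw_le hp hC haC) hη0.le (int_Lset hp ia hf)
    (g.integrable _) hfg
  rw [abs_le] at *
  constructor <;> linarith

/-- Lower semicontinuity of the moment. -/
lemma mom_lsc (e : Z) (p : ℝ) (hp : 1 < p) {ι : Type*} {l : Filter ι} [l.NeBot]
    (A : ι → FiniteMeasure Z) (a : FiniteMeasure Z)
    (hA : Tendsto A l (𝓝 a)) (y : ι → ℝ≥0∞) (y₀ : ℝ≥0∞) (hy : Tendsto y l (𝓝 y₀))
    (hAC : ∀ i, ∫⁻ z, ENNReal.ofReal (hw e p z) ∂(A i : Measure Z) ≤ y i) :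
    ∫⁻ z, ENNReal.ofReal (hw e p z) ∂(a : Measure Z) ≤ y₀ := by
  have hconv := FiniteMeasure.tendsto_iff_forall_lintegral_tendsto.1 hA
  let g : ℕ → BoundedContinuousFunction Z ℝ≥0 := fun n =>
    BoundedContinuousFunction.mkOfBound
      ⟨fun z => min (Real.toNNReal (hw e p z)) n,
        (continuous_real_toNNReal.comp (hw_cont e p hp)).min continuous_const⟩ n
      (fun x y => by
        rw [NNReal.dist_eq, abs_le]
        have h1 : ((min (Real.toNNReal (hw e p x)) n : ℝ≥0) : ℝ) ≤ n := by
          exact_mod_cast min_le_right _ _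
        have h2 : ((min (Real.toNNReal (hw e p y)) n : ℝ≥0) : ℝ) ≤ n := by
          exact_mod_cast min_le_right _ _
        have h3 := (min (Real.toNNReal (hw e p x)) n : ℝ≥0).coe_nonneg
        have h4 := (min (Real.toNNReal (hw e p y)) n : ℝ≥0).coe_nonneg
        constructor
        · simp only [ContinuousMap.coe_mk]; linarith
        · simp only [ContinuousMap.coe_mk]; linarith)
  have hg : ∀ n z, (g n z : ℝ≥0∞) = min (ENNReal.ofReal (hw e p z)) n := by
    intro n z
    change ((min (Real.toNNReal (hw e p z)) n : ℝ≥0) : ℝ≥0∞) = _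
    rw [ENNReal.coe_min]; rfl
  have hn : ∀ n, ∫⁻ z, (g n z : ℝ≥0∞) ∂(a : Measure Z) ≤ y₀ := fun n =>
    le_of_tendsto_of_tendsto' (hconv (g n)) hy fun i =>
      (lintegral_mono fun z => by rw [hg]; exact min_le_left _ _).trans (hAC i)
  have hsup : ∀ z, ENNReal.ofReal (hw e p z) = ⨆ n, (g n z : ℝ≥0∞) := by
    intro z
    apply le_antisymm
    · obtain ⟨n, hn⟩ := ENNReal.exists_nat_gt (ENNReal.ofReal_ne_top (r := hw e p z))
      refine le_trans ?_ (le_iSup _ n)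
      rw [hg, min_eq_left hn.le]
    · exact iSup_le fun n => by rw [hg]; exact min_le_left _ _
  simp_rw [hsup]
  rw [lintegral_iSup]
  · exact iSup_le hn
  · intro n
    exact (g n).continuous.measurable.coe_nnreal_ennreal
  · intro n m hnm z
    simp only [hg]
    exact min_le_min le_rfl (by exact_mod_cast hnm)

/-- Compactness of moment-bounded sets. -/
lemma mom_compact (e : Z) (hprop : ∀ r : ℝ, IsCompact (Metric.closedBall e r))
    (p : ℝ) (hp : 1 < p) (C : ℝ≥0) :
    ∃ K : Set (FiniteMeasure Z), IsCompact K ∧ ∀ a : FiniteMeasure Z,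
      ∫⁻ z, ENNReal.ofReal (hw e p z) ∂(a : Measure Z) ≤ C → a ∈ K := by
  refine ⟨_, isCompact_setOfPred_finiteMeasure_mass_le_compl_isCompact_le
    (u := fun n : ℕ => C * ((n : ℝ≥0) + 1)⁻¹) (K := fun n : ℕ => Metric.closedBall e (n + 1)) C ?_
    (fun n => hprop _) (Or.inl inferInstance), fun a ha => ⟨?_, fun n => ?_⟩⟩
  · have : Tendsto (fun n : ℕ => ((n : ℝ≥0) + 1)⁻¹) atTop (𝓝 0) := by
      have := tendsto_one_div_add_atTop_nhds_zero_nat (𝕜 := ℝ≥0)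
      simpa using this
    simpa using this.const_mul C
  · rw [← ENNReal.coe_le_coe, FiniteMeasure.ennreal_mass]
    refine le_trans ?_ ha
    rw [← lintegral_one]
    refine lintegral_mono fun z => ?_
    rw [← ENNReal.ofReal_one]
    exact ENNReal.ofReal_le_ofReal (hw_ge_one e p z)
  · rw [← div_eq_mul_inv, le_div_iff₀ (by positivity), ← ENNReal.coe_le_coe, ENNReal.coe_mul,
      FiniteMeasure.ennreal_coeFn_eq_coeFn_toMeasure, mul_comm]
    refine le_trans ?_ ((mul_meas_ge_le_lintegral (μ := (a : Measure Z))
      ((hw_cont e p hp).measurable.ennreal_ofReal)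
      (((n : ℝ≥0) + 1 : ℝ≥0) : ℝ≥0∞)).trans ha)
    gcongr
    intro z hz
    have hz' : (n : ℝ) + 1 < dist z e := by simpa using hz
    have : (((n : ℝ≥0) + 1 : ℝ≥0) : ℝ≥0∞) = ENNReal.ofReal ((n : ℝ) + 1) := by
      rw [ENNReal.ofReal]; congr 1
      ext; rw [Real.coe_toNNReal _ (by positivity)]; simp
    simp only [Set.mem_ofPred_eq]
    rw [this]
    exact ENNReal.ofReal_le_ofReal (hz'.le.trans (dist_le_hw e p hp z))

lemma tv_sub_le (a b : Measure Z) [IsFiniteMeasure a] [IsFiniteMeasure b] :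
    (a.toSignedMeasure - b.toSignedMeasure).totalVariation ≤ a + b := by
  unfold SignedMeasure.totalVariation
  rw [Measure.toJordanDecomposition_toSignedMeasure_sub]
  exact add_le_add Measure.sub_le Measure.sub_le

lemma sInteg_sub (a b : Measure Z) [IsFiniteMeasure a] [IsFiniteMeasure b] (f : Z → ℝ)
    (ha : Integrable f a) (hb : Integrable f b) :
    sInteg (a.toSignedMeasure - b.toSignedMeasure) f = ∫ z, f z ∂a - ∫ z, f z ∂b := by
  unfold sInteg
  rw [Measure.toJordanDecomposition_toSignedMeasure_sub,
    Measure.jordanDecompositionOfToSignedMeasureSub_posPart,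
    Measure.jordanDecompositionOfToSignedMeasureSub_negPart]
  have key : (a - b) + b = (b - a) + a := by
    have h := Measure.sub_toSignedMeasure_eq_toSignedMeasure_sub (μ := a) (ν := b)
    rw [← Measure.toSignedMeasure_eq_toSignedMeasure_iff, Measure.toSignedMeasure_add,
      Measure.toSignedMeasure_add]
    rw [sub_eq_sub_iff_add_eq_add] at h
    rw [add_comm (b - a).toSignedMeasure, h]
  have i1 : Integrable f (a - b) := ha.mono_measure Measure.sub_le
  have i2 : Integrable f (b - a) := hb.mono_measure Measure.sub_le
  have h2 := congrArg (fun m : Measure Z => ∫ z, f z ∂m) key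
  simp only [integral_add_measure i1 hb, integral_add_measure i2 ha] at h2
  linarith

lemma kr_set_zero (e : Z) (μ : SignedMeasure Z) :
    (0 : ℝ) ∈ {r : ℝ | ∃ f : Z → ℝ, f e = 0 ∧ LipschitzWith 1 f ∧ r = sInteg μ f} :=
  ⟨fun _ => 0, rfl, LipschitzWith.const' 0, by simp [sInteg]⟩

lemma krNorm_nonneg (e : Z) (μ : SignedMeasure Z) : 0 ≤ krNorm e μ :=
  Real.sSup_nonneg' ⟨0, kr_set_zero e μ, le_rfl⟩

lemma kruNorm_eq (e : Z) (μ : SignedMeasure Z) : kruNorm e μ = |μ Set.univ| + krNorm e μ := rfl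

lemma kruNorm_nonneg (e : Z) (μ : SignedMeasure Z) : 0 ≤ kruNorm e μ :=
  add_nonneg (abs_nonneg _) (krNorm_nonneg e μ)

lemma krNorm_le (e : Z) (μ : SignedMeasure Z) (ε : ℝ) (h : ∀ f ∈ Lset e, |sInteg μ f| ≤ ε) :
    krNorm e μ ≤ ε := by
  refine csSup_le ⟨0, kr_set_zero e μ⟩ ?_
  rintro r ⟨f, h0, h1, rfl⟩
  exact (le_abs_self _).trans (h f ⟨h0, h1⟩)

lemma krNorm_le_add (e : Z) (μ ν : SignedMeasure Z) (ε : ℝ)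
    (hb : BddAbove {r : ℝ | ∃ f : Z → ℝ, f e = 0 ∧ LipschitzWith 1 f ∧ r = sInteg ν f})
    (h : ∀ f ∈ Lset e, |sInteg μ f - sInteg ν f| ≤ ε) : krNorm e μ ≤ krNorm e ν + ε := by
  refine csSup_le ⟨0, kr_set_zero e μ⟩ ?_
  rintro r ⟨f, h0, h1, rfl⟩
  have h2 : sInteg ν f ≤ krNorm e ν := le_csSup hb ⟨f, h0, h1, rfl⟩
  have := (abs_le.1 (h f ⟨h0, h1⟩)).2
  linarith

lemma kr_bdd {e : Z} {p : ℝ} (hp : 1 < p) (a b : Measure Z) [IsFiniteMeasure a]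
    [IsFiniteMeasure b] (ha : Integrable (hw e p) a) (hb : Integrable (hw e p) b) :
    BddAbove {r : ℝ | ∃ f : Z → ℝ, f e = 0 ∧ LipschitzWith 1 f ∧
      r = sInteg (a.toSignedMeasure - b.toSignedMeasure) f} := by
  refine ⟨∫ z, hw e p z ∂a + ∫ z, hw e p z ∂b, ?_⟩
  rintro r ⟨f, h0, h1, rfl⟩
  have hf : f ∈ Lset e := ⟨h0, h1⟩
  rw [sInteg_sub a b f (int_Lset hp ha hf) (int_Lset hp hb hf)]
  have hz : ∀ z, |f z| ≤ hw e p z := fun z => (Lset_abs hf z).trans (dist_le_hw e p hp z)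
  have h2 := integral_mono (int_Lset hp ha hf) ha (fun z => (le_abs_self _).trans (hz z))
  have h3 := integral_mono (int_Lset hp hb hf).neg hb (fun z => (neg_le_abs _).trans (hz z))
  simp only [Pi.neg_apply, integral_neg] at h3
  linarith

/-- If `p > 1`, every sublevel set `{μ : G_{α,β}(μ) ≤ t}` of the regularizer
is (sequentially) compact in the topology induced by the Kantorovich–Rubinstein norm. -/
theorem Gab_sublevel_compact_kru [LocallyCompactSpace Z] [CompleteSpace Z]
    [TopologicalSpace.SeparableSpace Z] (hgeo : IsGeodesic Z) (e : Z)
    (p α β : ℝ) (hp : 1 < p) (hα : 0 ≤ α) (hβ : 0 < β) (t : ℝ)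
    (μ : ℕ → SignedMeasure Z) (hsub : ∀ n, Gab e p α β (μ n) ≤ (t : EReal)) :
    ∃ (φ : ℕ → ℕ) (μlim : SignedMeasure Z), StrictMono φ ∧ Gab e p α β μlim ≤ (t : EReal) ∧
      Tendsto (fun k => kruNorm e (μ (φ k) - μlim)) atTop (nhds 0) := by
  have hprop := geo_proper hgeo e
  have hM : ∀ n, MemMp e p (μ n) ∧
      α * kruNorm e (μ n) + β * (momLint e p (μ n)).toReal ≤ t := by
    intro n
    have h := hsub n
    unfold Gab at h
    split_ifs at h with h1
    · exact ⟨h1, by exact_mod_cast h⟩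
    · exact absurd h (by simp)
  have hfin : ∀ n, momLint e p (μ n) ≠ ⊤ := by
    intro n
    have h1 : MemMp e p (μ n) := (hM n).1
    have : momLint e p (μ n) = (μ n).totalVariation Set.univ +
        ∫⁻ z, ENNReal.ofReal (dist z e ^ p) ∂(μ n).totalVariation := by
      unfold momLint
      rw [← lintegral_one, ← lintegral_add_left measurable_const]
      refine lintegral_congr fun z => ?_
      rw [ENNReal.ofReal_add zero_le_one (Real.rpow_nonneg dist_nonneg p), ENNReal.ofReal_one]
    rw [this]
    exact ENNReal.add_ne_top.2 ⟨measure_ne_top _ _, h1.ne⟩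
  set C : ℝ := t / β with hCdef
  have hmomx : ∀ n, (momLint e p (μ n)).toReal ≤ (t - α * kruNorm e (μ n)) / β := by
    intro n
    rw [le_div_iff₀ hβ]
    linarith [(hM n).2]
  have hmomE : ∀ n, momLint e p (μ n) ≤ ENNReal.ofReal ((t - α * kruNorm e (μ n)) / β) := by
    intro n
    rw [← ENNReal.ofReal_toReal (hfin n)]
    exact ENNReal.ofReal_le_ofReal (hmomx n)
  have hxC : ∀ n, (t - α * kruNorm e (μ n)) / β ≤ C := by
    intro n
    have := mul_nonneg hα (kruNorm_nonneg e (μ n))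
    exact div_le_div_of_nonneg_right (by linarith) hβ.le
  have hC : 0 ≤ C := ENNReal.toReal_nonneg.trans ((hmomx 0).trans (hxC 0))
  have hmomC : ∀ n, momLint e p (μ n) ≤ ENNReal.ofReal C := fun n =>
    (hmomE n).trans (ENNReal.ofReal_le_ofReal (hxC n))
  let A : ℕ → FiniteMeasure Z := fun n => ⟨(μ n).toJordanDecomposition.posPart, inferInstance⟩
  let B : ℕ → FiniteMeasure Z := fun n => ⟨(μ n).toJordanDecomposition.negPart, inferInstance⟩
  have hμ : ∀ n, μ n = (A n : Measure Z).toSignedMeasure - (B n : Measure Z).toSignedMeasure :=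
    fun n => ((μ n).toSignedMeasure_toJordanDecomposition).symm
  have hABm : ∀ n, ∫⁻ z, ENNReal.ofReal (hw e p z) ∂((A n + B n : FiniteMeasure Z) : Measure Z)
      = momLint e p (μ n) := fun n => rfl
  have hAC : ∀ n, ∫⁻ z, ENNReal.ofReal (hw e p z) ∂(A n : Measure Z) ≤ ENNReal.ofReal C := by
    intro n
    refine le_trans (lintegral_mono' ?_ le_rfl) ((hABm n).le.trans (hmomC n))
    rw [FiniteMeasure.toMeasure_add]
    exact Measure.le_add_right le_rfl
  have hBC : ∀ n, ∫⁻ z, ENNReal.ofReal (hw e p z) ∂(B n : Measure Z) ≤ ENNReal.ofReal C := by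
    intro n
    refine le_trans (lintegral_mono' ?_ le_rfl) ((hABm n).le.trans (hmomC n))
    rw [FiniteMeasure.toMeasure_add]
    exact Measure.le_add_left le_rfl
  obtain ⟨K, hK, hKmem⟩ := mom_compact e hprop p hp (Real.toNNReal C)
  set U : Filter ℕ := (hyperfilter ℕ : Filter ℕ) with hU
  have hUtop : U ≤ atTop := Nat.hyperfilter_le_atTop
  obtain ⟨⟨a, b⟩, -, hab⟩ := (hK.prod hK).ultrafilter_le_nhds
    ((hyperfilter ℕ).map fun n => (A n, B n)) (by
      rw [le_principal_iff]
      exact Filter.mem_map.2 (Filter.univ_mem' fun n => ⟨hKmem _ (hAC n), hKmem _ (hBC n)⟩))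
  have hab' : Tendsto (fun n => (A n, B n)) U (𝓝 (a, b)) := hab
  have hA : Tendsto A U (𝓝 a) := (continuous_fst.tendsto _).comp hab'
  have hB : Tendsto B U (𝓝 b) := (continuous_snd.tendsto _).comp hab'
  have hABt : Tendsto (fun n => A n + B n) U (𝓝 (a + b)) := hA.add hB
  have haC := mom_lsc e p hp A a hA _ _ tendsto_const_nhds hAC
  have hbC := mom_lsc e p hp B b hB _ _ tendsto_const_nhds hBC
  have ia := int_hw hp (haC.trans_lt ENNReal.ofReal_lt_top)
  have ib := int_hw hp (hbC.trans_lt ENNReal.ofReal_lt_top)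
  have iA := fun n => int_hw hp ((hAC n).trans_lt ENNReal.ofReal_lt_top)
  have iB := fun n => int_hw hp ((hBC n).trans_lt ENNReal.ofReal_lt_top)
  set ν : SignedMeasure Z := (a : Measure Z).toSignedMeasure - (b : Measure Z).toSignedMeasure
    with hν
  have hdiff : ∀ n, μ n - ν = ((A n : Measure Z) + (b : Measure Z)).toSignedMeasure -
      ((B n : Measure Z) + (a : Measure Z)).toSignedMeasure := by
    intro n
    rw [hμ n, hν, Measure.toSignedMeasure_add, Measure.toSignedMeasure_add]
    abel
  have hsI : ∀ n, ∀ f ∈ Lset e, sInteg (μ n) f =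
      ∫ z, f z ∂(A n : Measure Z) - ∫ z, f z ∂(B n : Measure Z) := by
    intro n f hf
    conv_lhs => rw [hμ n]
    exact sInteg_sub _ _ f (int_Lset hp (iA n) hf) (int_Lset hp (iB n) hf)
  have hsν : ∀ f ∈ Lset e, sInteg ν f =
      ∫ z, f z ∂(a : Measure Z) - ∫ z, f z ∂(b : Measure Z) := by
    intro f hf
    exact sInteg_sub _ _ f (int_Lset hp ia hf) (int_Lset hp ib hf)
  have hsd : ∀ n, ∀ f ∈ Lset e, sInteg (μ n - ν) f = sInteg (μ n) f - sInteg ν f := by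
    intro n f hf
    have jA := int_Lset hp (iA n) hf
    have jB := int_Lset hp (iB n) hf
    have ja := int_Lset hp ia hf
    have jb := int_Lset hp ib hf
    rw [hsI n f hf, hsν f hf, hdiff n, sInteg_sub _ _ f (jA.add_measure jb) (jB.add_measure ja),
      integral_add_measure jA jb, integral_add_measure jB ja]
    ring
  have hunif : ∀ ε > 0, ∀ᶠ n in U, ∀ f ∈ Lset e, |sInteg (μ n) f - sInteg ν f| ≤ ε := by
    intro ε hε
    filter_upwards [unif_conv e hprop p hp A a hA C hC hAC haC (ε / 2) (by linarith),
      unif_conv e hprop p hp B b hB C hC hBC hbC (ε / 2) (by linarith)] with n h1 h2 f hf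
    rw [hsI n f hf, hsν f hf]
    have h1 := h1 f hf
    have h2 := h2 f hf
    rw [abs_le] at *
    constructor <;> linarith
  have huniv : Tendsto (fun n => (μ n) Set.univ) U (𝓝 (ν Set.univ)) := by
    have h1 := (NNReal.continuous_coe.tendsto _).comp hA.mass
    have h2 := (NNReal.continuous_coe.tendsto _).comp hB.mass
    have h3 := h1.sub h2
    have e1 : ∀ n, (μ n) Set.univ = ((A n).mass : ℝ) - ((B n).mass : ℝ) := by
      intro n
      rw [hμ n, Measure.toSignedMeasure_sub_apply MeasurableSet.univ]
      rfl
    have e2 : ν Set.univ = (a.mass : ℝ) - (b.mass : ℝ) := by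
      rw [hν, Measure.toSignedMeasure_sub_apply MeasurableSet.univ]
      rfl
    simp_rw [e1, e2]
    exact h3
  have hkr : Tendsto (fun n => krNorm e (μ n)) U (𝓝 (krNorm e ν)) := by
    rw [Metric.tendsto_nhds]
    intro ε hε
    filter_upwards [hunif (ε / 2) (by linarith)] with n hn
    have h1 := krNorm_le_add e (μ n) ν (ε / 2) (kr_bdd hp _ _ ia ib) hn
    have h2 := krNorm_le_add e ν (μ n) (ε / 2)
      (by rw [hμ n]; exact kr_bdd hp _ _ (iA n) (iB n))
      (fun f hf => by rw [abs_sub_comm]; exact hn f hf)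
    rw [Real.dist_eq, abs_lt]
    constructor <;> linarith
  have hkru : Tendsto (fun n => kruNorm e (μ n)) U (𝓝 (kruNorm e ν)) := by
    simp_rw [kruNorm_eq]
    exact huniv.abs.add hkr
  have hdiff0 : Tendsto (fun n => kruNorm e (μ n - ν)) U (𝓝 0) := by
    have h1 : Tendsto (fun n => |(μ n - ν) Set.univ|) U (𝓝 0) := by
      have := (huniv.sub_const (ν Set.univ)).abs
      simpa using this
    have h2 : Tendsto (fun n => krNorm e (μ n - ν)) U (𝓝 0) := by
      rw [Metric.tendsto_nhds]
      intro ε hε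
      filter_upwards [hunif (ε / 2) (by linarith)] with n hn
      have h1 := krNorm_le e (μ n - ν) (ε / 2) fun f hf => by
        rw [hsd n f hf]; exact hn f hf
      have h3 := krNorm_nonneg e (μ n - ν)
      rw [Real.dist_eq, abs_lt]
      constructor <;> linarith
    simpa [kruNorm_eq] using h1.add h2
  have hG : Gab e p α β ν ≤ (t : EReal) := by
    set x := (t - α * kruNorm e ν) / β with hx
    have hxt : Tendsto (fun n => (t - α * kruNorm e (μ n)) / β) U (𝓝 x) :=
      ((hkru.const_mul α).const_sub t).div_const β
    have hx0 : 0 ≤ x := ge_of_tendsto' hxt fun n => ENNReal.toReal_nonneg.trans (hmomx n)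
    have h1 := mom_lsc e p hp _ _ hABt _ _ (ENNReal.tendsto_ofReal hxt)
      (fun n => (hABm n).le.trans (hmomE n))
    have h2 : momLint e p ν ≤ ENNReal.ofReal x := by
      refine le_trans (lintegral_mono' ?_ le_rfl) h1
      rw [FiniteMeasure.toMeasure_add]
      exact tv_sub_le _ _
    have h3 : MemMp e p ν := by
      refine lt_of_le_of_lt (lintegral_mono fun z => ?_) (h2.trans_lt ENNReal.ofReal_lt_top)
      exact ENNReal.ofReal_le_ofReal (by linarith)
    unfold Gab
    rw [if_pos h3]
    have h4 : (momLint e p ν).toReal ≤ x := ENNReal.toReal_le_of_le_ofReal hx0 h2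
    rw [hx, le_div_iff₀ hβ] at h4
    exact_mod_cast (by linarith : α * kruNorm e ν + β * (momLint e p ν).toReal ≤ t)
  have hfreq : ∀ m : ℕ, ∃ᶠ k in atTop, kruNorm e (μ k - ν) < 1 / ((m : ℝ) + 1) := by
    intro m
    have : ∀ᶠ k in U, kruNorm e (μ k - ν) < 1 / ((m : ℝ) + 1) :=
      hdiff0.eventually (gt_mem_nhds (by positivity))
    exact this.frequently.filter_mono hUtop
  obtain ⟨φ, hφ, hφ'⟩ := extraction_forall_of_frequently hfreq
  exact ⟨φ, ν, hφ, hG, squeeze_zero (fun k => kruNorm_nonneg e _) (fun k => (hφ' k).le)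
    tendsto_one_div_add_atTop_nhds_zero_nat⟩
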